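/- On the Klein bottle, the Dehn twist along a two-sided meridian curve (a non-separating two-sided simple closed curve) in one direction is isotopic to the Dehn twist along the same curve in the opposite direction; that is, such a Dehn twist is isotopic to its inverse. -/

import Mathlib

/-!
The Klein bottle is realized as the quotient of `ℝ²` by the equivalence relation generated
by `(x, y) ~ (x + 1, y)` and `(x, y) ~ (-x, y + 1)`.  The circle `y = 1/2` (image of
`x ↦ [(x, 1/2)]`) is a meridian: a non-separating two-sided simple closed curve (its
neighborhood `0 < y < 1` is an annulus, and the complement of the curve is connected).
The Dehn twist along this meridian is realized by the map `[(x, y)] ↦ [(x + g y, y)]`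
where `g y = (1 - cos (π y)) / 2`, which winds once in the `x`-direction as `y` crosses
the annular neighborhood of the meridian; the opposite Dehn twist is
`[(x, y)] ↦ [(x - g y, y)]`.  The theorem states that the Dehn twist along the meridian is
isotopic (through homeomorphisms of the Klein bottle) to the opposite Dehn twist, i.e. to
its inverse.
-/

open Real

noncomputable section

/-- The generating relation for the Klein bottle as a quotient of `ℝ²`:
`(x, y) ~ (x + 1, y)` and `(x, y) ~ (-x, y + 1)`. -/
def KleinRel (p q : ℝ × ℝ) : Prop :=
  (q.1 = p.1 + 1 ∧ q.2 = p.2) ∨ (q.1 = -p.1 ∧ q.2 = p.2 + 1)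

/-- The Klein bottle: the nonorientable closed surface of Euler characteristic `0`. -/
def KleinBottle : Type := Quot KleinRel

instance : TopologicalSpace KleinBottle :=
  inferInstanceAs (TopologicalSpace (Quot KleinRel))

/-- The quotient projection `ℝ² → KleinBottle`. -/
def KleinBottle.mk (p : ℝ × ℝ) : KleinBottle := Quot.mk KleinRel p

/-- The twisting profile of the Dehn twist along the meridian `y = 1/2`:
a function increasing from `0` to `1` across the annular neighborhood `0 < y < 1`
of the meridian, satisfying the compatibility `g (y + 1) = 1 - g y`. -/
def kleinTwistProfile (y : ℝ) : ℝ := (1 - Real.cos (π * y)) / 2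

theorem kleinTwistProfile_add_one (y : ℝ) :
    kleinTwistProfile (y + 1) = 1 - kleinTwistProfile y := by
  unfold kleinTwistProfile
  rw [show π * (y + 1) = π * y + π by ring, Real.cos_add_pi]
  ring

/-- The Dehn twist along the meridian `y = 1/2` of the Klein bottle (in one direction). -/
def kleinDehnTwist : KleinBottle → KleinBottle :=
  Quot.lift (fun p => KleinBottle.mk (p.1 + kleinTwistProfile p.2, p.2)) (by
    rintro ⟨ax, ay⟩ ⟨bx, by'⟩ (⟨h1, h2⟩ | ⟨h1, h2⟩) <;> dsimp only at h1 h2 <;> subst h1 <;>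
      subst h2 <;> dsimp only
    · exact Quot.sound (Or.inl ⟨by ring, rfl⟩)
    · calc
        KleinBottle.mk (ax + kleinTwistProfile ay, ay) =
            KleinBottle.mk (-(ax + kleinTwistProfile ay), ay + 1) :=
          Quot.sound (Or.inr ⟨rfl, rfl⟩)
        _ = KleinBottle.mk (-(ax + kleinTwistProfile ay) + 1, ay + 1) :=
          Quot.sound (Or.inl ⟨rfl, rfl⟩)
        _ = KleinBottle.mk (-ax + kleinTwistProfile (ay + 1), ay + 1) := by
          have hx : -(ax + kleinTwistProfile ay) + 1 = -ax + kleinTwistProfile (ay + 1) := by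
            rw [kleinTwistProfile_add_one]; ring
          rw [hx])

/-- The Dehn twist along the meridian `y = 1/2` of the Klein bottle in the opposite
direction: the inverse of `kleinDehnTwist`. -/
def kleinDehnTwistInv : KleinBottle → KleinBottle :=
  Quot.lift (fun p => KleinBottle.mk (p.1 - kleinTwistProfile p.2, p.2)) (by
    rintro ⟨ax, ay⟩ ⟨bx, by'⟩ (⟨h1, h2⟩ | ⟨h1, h2⟩) <;> dsimp only at h1 h2 <;> subst h1 <;>
      subst h2 <;> dsimp only
    · exact Quot.sound (Or.inl ⟨by ring, rfl⟩)
    · calc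
        KleinBottle.mk (ax - kleinTwistProfile ay, ay) =
            KleinBottle.mk (-(ax - kleinTwistProfile ay), ay + 1) :=
          Quot.sound (Or.inr ⟨rfl, rfl⟩)
        _ = KleinBottle.mk (-ax + kleinTwistProfile ay, ay + 1) := by
          have hx : -(ax - kleinTwistProfile ay) = -ax + kleinTwistProfile ay := by ring
          rw [hx]
        _ = KleinBottle.mk (-ax - kleinTwistProfile (ay + 1), ay + 1) := by
          have h : KleinRel (-ax - kleinTwistProfile (ay + 1), ay + 1)
              (-ax + kleinTwistProfile ay, ay + 1) := by
            refine Or.inl ⟨?_, rfl⟩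
            dsimp only
            rw [kleinTwistProfile_add_one]; ring
          exact (Quot.sound h).symm)

theorem KleinBottle.isQuotientMap_mk : Topology.IsQuotientMap KleinBottle.mk :=
  isQuotientMap_quot_mk

theorem KleinBottle.mk_add_intCast (x y : ℝ) (n : ℤ) :
    KleinBottle.mk (x + n, y) = KleinBottle.mk (x, y) := by
  have step (z : ℝ) : KleinBottle.mk (z, y) = KleinBottle.mk (z + 1, y) :=
    Quot.sound (Or.inl ⟨rfl, rfl⟩)
  induction n using Int.induction_on with
  | zero => simp
  | succ k ih =>
    rw [← ih, step (x + ((k : ℤ) : ℝ))]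
    push_cast
    rw [add_assoc]
  | pred k ih =>
    rw [← ih, step]
    push_cast
    congr 2
    ring

theorem KleinBottle.mk_neg_add_one (x y : ℝ) :
    KleinBottle.mk (-x, y + 1) = KleinBottle.mk (x, y) :=
  Eq.symm (Quot.sound (r := KleinRel) (Or.inr ⟨rfl, rfl⟩))

/-- The fibrewise rotation `[(x, y)] ↦ [(x + φ y, y)]` of the Klein bottle, which is well defined
when `φ y + φ (y + 1)` is a constant integer. -/
def kleinShear (φ : ℝ → ℝ) (hφ : ∃ n : ℤ, ∀ y, φ y + φ (y + 1) = n) :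
    KleinBottle → KleinBottle :=
  Quot.lift (fun p => KleinBottle.mk (p.1 + φ p.2, p.2)) (by
    obtain ⟨n, hn⟩ := hφ
    rintro ⟨a, b⟩ ⟨c, d⟩ (⟨h1, h2⟩ | ⟨h1, h2⟩) <;> dsimp only at h1 h2 ⊢ <;> subst h1 h2
    · rw [← KleinBottle.mk_add_intCast (a + φ d) d 1]
      push_cast
      congr 2
      ring
    · rw [← KleinBottle.mk_neg_add_one, ← KleinBottle.mk_add_intCast _ _ n, ← hn b]
      congr 2
      ring)

theorem kleinShear_mk (φ : ℝ → ℝ) (hφ : ∃ n : ℤ, ∀ y, φ y + φ (y + 1) = n) (p : ℝ × ℝ) :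
    kleinShear φ hφ (KleinBottle.mk p) = KleinBottle.mk (p.1 + φ p.2, p.2) :=
  rfl

theorem continuous_kleinShear {φ : ℝ → ℝ} (hφ : ∃ n : ℤ, ∀ y, φ y + φ (y + 1) = n)
    (hc : Continuous φ) : Continuous (kleinShear φ hφ) :=
  KleinBottle.isQuotientMap_mk.continuous_iff.2
    (KleinBottle.isQuotientMap_mk.continuous.comp
      (by fun_prop : Continuous fun p : ℝ × ℝ => (p.1 + φ p.2, p.2)))

theorem kleinShear_kleinShear {φ ψ : ℝ → ℝ} (hφ : ∃ n : ℤ, ∀ y, φ y + φ (y + 1) = n)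
    (hψ : ∃ n : ℤ, ∀ y, ψ y + ψ (y + 1) = n) (h : ∀ y, φ y + ψ y = 0) (q : KleinBottle) :
    kleinShear ψ hψ (kleinShear φ hφ q) = q := by
  obtain ⟨p, rfl⟩ := KleinBottle.isQuotientMap_mk.surjective q
  simp only [kleinShear_mk, add_assoc, h, add_zero]

theorem isHomeomorph_kleinShear {φ : ℝ → ℝ} (hφ : ∃ n : ℤ, ∀ y, φ y + φ (y + 1) = n)
    (hc : Continuous φ) : IsHomeomorph (kleinShear φ hφ) := by
  have hneg : ∃ n : ℤ, ∀ y, -φ y + -φ (y + 1) = n := by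
    obtain ⟨n, hn⟩ := hφ
    refine ⟨-n, fun y => ?_⟩
    rw [Int.cast_neg, ← hn y]
    ring
  exact Homeomorph.isHomeomorph
    { toFun := kleinShear φ hφ
      invFun := kleinShear (fun y => -φ y) hneg
      left_inv := kleinShear_kleinShear hφ hneg fun y => add_neg_cancel _
      right_inv := kleinShear_kleinShear hneg hφ fun y => neg_add_cancel _
      continuous_toFun := continuous_kleinShear hφ hc
      continuous_invFun := continuous_kleinShear hneg hc.neg }

theorem continuous_kleinTwistProfile : Continuous kleinTwistProfile := by
  unfold kleinTwistProfile
  fun_prop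

theorem kleinTwistProfile_translate (s : ℝ) :
    ∃ n : ℤ, ∀ y, kleinTwistProfile (y + s) + kleinTwistProfile (y + 1 + s) = n :=
  ⟨1, fun y => by rw [add_right_comm, kleinTwistProfile_add_one]; simp⟩

/-- On the Klein bottle, the Dehn twist along the two-sided meridian curve
(a non-separating two-sided simple closed curve) in one direction is isotopic, through
homeomorphisms of the Klein bottle, to the Dehn twist along the same curve in the opposite
direction; that is, the Dehn twist is isotopic to its inverse. -/
theorem kleinDehnTwist_isotopic_inv :
    ∃ F : unitInterval → KleinBottle → KleinBottle,
      Continuous (fun p : unitInterval × KleinBottle => F p.1 p.2) ∧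
        (∀ t, IsHomeomorph (F t)) ∧ F 0 = kleinDehnTwist ∧ F 1 = kleinDehnTwistInv := by
  refine ⟨fun t => kleinShear (fun y => kleinTwistProfile (y + t)) (kleinTwistProfile_translate t),
    ?_, fun t => ?_, ?_, ?_⟩
  · have hc := continuous_kleinTwistProfile
    refine KleinBottle.isQuotientMap_mk.continuous_lift_prod_right ?_
    exact KleinBottle.isQuotientMap_mk.continuous.comp
      (by fun_prop : Continuous fun p : unitInterval × (ℝ × ℝ) =>
        (p.2.1 + kleinTwistProfile (p.2.2 + p.1), p.2.2))
  · have hc := continuous_kleinTwistProfile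
    exact isHomeomorph_kleinShear _ (by fun_prop)
  · funext q
    obtain ⟨p, rfl⟩ := KleinBottle.isQuotientMap_mk.surjective q
    change KleinBottle.mk _ = KleinBottle.mk _
    simp
  · funext q
    obtain ⟨p, rfl⟩ := KleinBottle.isQuotientMap_mk.surjective q
    change KleinBottle.mk _ = KleinBottle.mk (p.1 - kleinTwistProfile p.2, p.2)
    rw [← KleinBottle.mk_add_intCast (p.1 - kleinTwistProfile p.2) p.2 1]
    simp only [Set.Icc.coe_one, kleinTwistProfile_add_one, Int.cast_one]
    congr 2
    ring

end
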